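/- Let q = p be prime, n = n_1 + n_2, and let G_I ≤ GL_n(F_p) be the group of block upper triangular matrices [[A, B], [0, C]] with A ∈ GL_{n_1}(F_p), C ∈ G(m,1,n_2) and B arbitrary, where m ∈ {1, 2} and p is odd if m = 2 (this G_I is the Weyl group of a restricted Cartan type Lie algebra of type W, S, or H). Then the monomial x_1^{p^{n_1} − p^{n_1−1} − 1} x_2^{p^{n_1} − p^{n_1−2} − 1} ⋯ x_{n_1}^{p^{n_1} − 2} · Π_{j=1}^{n_2} x_{n_1+j}^{m(n_2+1−j)·p^{n_1} − 1} generates a block basis for the coinvariant algebra P_{G_I}: the set of all its monomial factors projects to an F_p-basis of P/I_{G_I}. -/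

import Mathlib

open MvPolynomial Finset

/-- The action of a matrix `g` on `F_p[x_1, …, x_n]`: the algebra map sending
`x_j` to `Σ_i g_{ij} x_i`. -/
noncomputable def matAct {K : Type*} [Field K] {n : ℕ} (g : Matrix (Fin n) (Fin n) K) :
    MvPolynomial (Fin n) K →ₐ[K] MvPolynomial (Fin n) K :=
  aeval fun j => ∑ i, C (g i j) * X i

/-- The subalgebra of polynomials invariant under every matrix in `G`. -/
noncomputable def invariants {K : Type*} [Field K] {n : ℕ} (G : Set (GL (Fin n) K)) :
    Subalgebra K (MvPolynomial (Fin n) K) where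
  carrier := {f | ∀ g ∈ G, matAct ((g : GL (Fin n) K) : Matrix (Fin n) (Fin n) K) f = f}
  mul_mem' := by
    intro a b ha hb g hg
    rw [map_mul, ha g hg, hb g hg]
  add_mem' := by
    intro a b ha hb g hg
    rw [map_add, ha g hg, hb g hg]
  algebraMap_mem' := by
    intro c g hg
    simp [matAct]

/-- The ideal generated by the homogeneous `G`-invariants of positive degree;
the quotient by it is the algebra of coinvariants. -/
noncomputable def coinvIdeal {K : Type*} [Field K] {n : ℕ} (G : Set (GL (Fin n) K)) :
    Ideal (MvPolynomial (Fin n) K) :=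
  Ideal.span {f | f ∈ invariants G ∧ ∃ d, 0 < d ∧ f.IsHomogeneous d}

/-- The Weyl group of a restricted Cartan type Lie algebra of type `W`, `S` or
`H`: block upper triangular matrices `[[A, B], [0, C]]` with `A ∈ GL_{n1}(F_p)`
arbitrary invertible, `B` arbitrary, and `C ∈ G(m,1,n2)` a monomial matrix whose
nonzero entries are `m`-th roots of unity. -/
def cartanWeyl (K : Type*) [Field K] (n1 n2 m : ℕ) : Set (GL (Fin (n1 + n2)) K) :=
  {g | (∀ s t : Fin (n1 + n2), n1 ≤ (s : ℕ) → (t : ℕ) < n1 →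
          (g : Matrix (Fin (n1 + n2)) (Fin (n1 + n2)) K) s t = 0) ∧
    ∃ (σ : Equiv.Perm (Fin n2)) (w : Fin n2 → K), (∀ j, w j ^ m = 1) ∧
      ∀ j k : Fin n2,
        (g : Matrix (Fin (n1 + n2)) (Fin (n1 + n2)) K)
            (Fin.natAdd n1 j) (Fin.natAdd n1 k) =
          if j = σ k then w k else 0}

section LowerBound

variable {K : Type*} [Field K] {n : ℕ}

lemma matAct_X (g : Matrix (Fin n) (Fin n) K) (j : Fin n) :
    matAct g (X j) = ∑ i, C (g i j) * X i := by
  simp [matAct]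

lemma matAct_injective :
    Function.Injective (matAct : Matrix (Fin n) (Fin n) K → _) := by
  intro g h hgh
  ext i j
  have := congrArg (coeff (Finsupp.single i 1)) (congrArg (fun φ => φ (X j)) hgh)
  simpa [matAct_X, coeff_sum, coeff_C_mul, coeff_X, Finsupp.single_left_inj] using this

lemma homogeneousComponent_mul_of_isHomogeneous {g : MvPolynomial (Fin n) K} {e : ℕ}
    (hg : g.IsHomogeneous e) (a : MvPolynomial (Fin n) K) (d : ℕ) :
    homogeneousComponent d (a * g) =
      if e ≤ d then homogeneousComponent (d - e) a * g else 0 := by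
  conv_lhs => rw [← sum_homogeneousComponent a, Finset.sum_mul, map_sum]
  have h : ∀ i, homogeneousComponent d (homogeneousComponent i a * g) =
      if d = i + e then homogeneousComponent i a * g else 0 := fun i =>
    homogeneousComponent_of_mem ((homogeneousComponent_isHomogeneous i a).mul hg)
  simp only [h]
  split_ifs with hed
  · rw [Finset.sum_eq_single (d - e)]
    · rw [if_pos (by omega)]
    · intro b _ hb
      rw [if_neg (by omega)]
    · intro hb
      rw [if_pos (by omega),
        homogeneousComponent_eq_zero _ _ (by rw [Finset.mem_range] at hb; omega), zero_mul]
  · exact Finset.sum_eq_zero fun i _ => by rw [if_neg (by omega)]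

/-- Graded Nakayama lemma: homogeneous elements that span the coinvariants generate the whole
polynomial ring as a module over the invariants. -/
lemma mem_span_invariants (S : Set (GL (Fin n) K)) {ι : Type*}
    (v : ι → MvPolynomial (Fin n) K) (hv : ∀ i, ∃ d, (v i).IsHomogeneous d)
    (hspan : Submodule.span K (Set.range fun i => Ideal.Quotient.mk (coinvIdeal S) (v i)) = ⊤)
    (f : MvPolynomial (Fin n) K) :
    f ∈ Submodule.span (invariants S) (Set.range v) := by
  have main : ∀ d, ∀ f : MvPolynomial (Fin n) K,
      homogeneousComponent d f ∈ Submodule.span (invariants S) (Set.range v) := by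
    intro d
    induction d using Nat.strong_induction_on with
    | _ d ih =>
    intro f
    have hf : Ideal.Quotient.mk (coinvIdeal S) f ∈
        Submodule.span K (Set.range fun i => Ideal.Quotient.mk (coinvIdeal S) (v i)) := by
      rw [hspan]; trivial
    obtain ⟨N, c, w, hw⟩ := Submodule.mem_span_set'.1 hf
    choose k hk using fun i => (w i).2
    have hI : f - ∑ i, c i • v (k i) ∈ coinvIdeal S := by
      rw [← Ideal.Quotient.eq_zero_iff_mem, map_sub, sub_eq_zero, ← hw, map_sum]
      refine Finset.sum_congr rfl fun i _ => ?_
      rw [← hk i]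
      rfl
    obtain ⟨M, a, g, hg⟩ := Submodule.mem_span_set'.1 hI
    have hf' : f = ∑ i, c i • v (k i) + ∑ i, a i * (g i : MvPolynomial (Fin n) K) := by
      simp only [smul_eq_mul] at hg
      rw [hg]; ring
    rw [hf', map_add, map_sum, map_sum]
    refine add_mem (sum_mem fun i _ => ?_) (sum_mem fun i _ => ?_)
    · obtain ⟨e, he⟩ := hv (k i)
      rw [map_smul, homogeneousComponent_of_mem he]
      split_ifs
      · have := Submodule.smul_mem (Submodule.span (invariants S) (Set.range v))
          (algebraMap K (invariants S) (c i)) (Submodule.subset_span ⟨k i, rfl⟩)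
        rwa [algebraMap_smul] at this
      · rw [smul_zero]; exact zero_mem _
    · obtain ⟨hgi, e, he, hge⟩ := (g i).2
      rw [homogeneousComponent_mul_of_isHomogeneous hge]
      split_ifs
      · have := Submodule.smul_mem _ (⟨g i, hgi⟩ : invariants S) (ih (d - e) (by omega) (a i))
        rwa [Subalgebra.smul_def, smul_eq_mul, mul_comm] at this
      · exact zero_mem _
  rw [← sum_homogeneousComponent f]
  exact sum_mem fun i _ => main i f

/-- A homogeneous spanning family of the coinvariants of `S` has at least `|S|` members. -/
lemma card_le_of_span_coinvariants (S : Set (GL (Fin n) K)) [Finite S] {ι : Type*} [Fintype ι]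
    (v : ι → MvPolynomial (Fin n) K) (hv : ∀ i, ∃ d, (v i).IsHomogeneous d)
    (hspan : Submodule.span K (Set.range fun i => Ideal.Quotient.mk (coinvIdeal S) (v i)) = ⊤) :
    Nat.card S ≤ Fintype.card ι := by
  classical
  have := Fintype.ofFinite S
  let φ : S → (MvPolynomial (Fin n) K →* MvPolynomial (Fin n) K) := fun g =>
    (matAct ((g : GL (Fin n) K) : Matrix (Fin n) (Fin n) K) : _ →* _)
  have hφ : Function.Injective φ := by
    intro g h hgh
    refine Subtype.ext (Units.ext (matAct_injective ?_))
    ext1 i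
    exact DFunLike.congr_fun hgh (X i)
  have hli := (linearIndependent_monoidHom (MvPolynomial (Fin n) K)
    (MvPolynomial (Fin n) K)).comp φ hφ
  rw [Fintype.linearIndependent_iff] at hli
  have hu : LinearIndependent (MvPolynomial (Fin n) K) (fun (g : S) (i : ι) => φ g (v i)) := by
    rw [Fintype.linearIndependent_iff]
    intro c hc
    refine hli c (funext fun f => ?_)
    have hf := mem_span_invariants S v hv hspan f
    simp only [Function.comp_apply, Finset.sum_apply, Pi.smul_apply, smul_eq_mul, Pi.zero_apply]
    induction hf using Submodule.span_induction with
    | mem x hx =>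
      obtain ⟨i, rfl⟩ := hx
      simpa using congrFun hc i
    | zero => simp [φ]
    | add x y _ _ hx hy =>
      have : ∀ g, φ g (x + y) = φ g x + φ g y := fun g => map_add (matAct _) x y
      simp only [this, mul_add, Finset.sum_add_distrib, hx, hy, add_zero]
    | smul a x _ hx =>
      have : ∀ g, φ g (a • x) = a * φ g x := fun g => by
        rw [Subalgebra.smul_def, smul_eq_mul, map_mul]
        congr 1
        exact a.2 g g.2
      simp only [this, mul_left_comm _ (a : MvPolynomial (Fin n) K), ← Finset.mul_sum, hx, mul_zero]
  have := hu.fintype_card_le_finrank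
  rwa [Module.finrank_fintype_fun_eq_card, ← Nat.card_eq_fintype_card] at this

/-- A homogeneous spanning family of the coinvariants of `S` with at most `|S|` members is
linearly independent. -/
lemma linearIndependent_of_span_coinvariants (S : Set (GL (Fin n) K)) [Finite S]
    {ι : Type*} [Fintype ι] (hcard : Fintype.card ι ≤ Nat.card S)
    (v : ι → MvPolynomial (Fin n) K) (hv : ∀ i, ∃ d, (v i).IsHomogeneous d)
    (hspan : Submodule.span K (Set.range fun i => Ideal.Quotient.mk (coinvIdeal S) (v i)) = ⊤) :
    LinearIndependent K (fun i => Ideal.Quotient.mk (coinvIdeal S) (v i)) := by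
  classical
  rw [linearIndependent_iff_notMem_span]
  intro i hi
  have h := card_le_of_span_coinvariants S (fun j : {j // j ≠ i} => v j) (fun j => hv j) (by
    rw [eq_top_iff, ← hspan, Submodule.span_le]
    rintro _ ⟨j, rfl⟩
    have key : (fun i => Ideal.Quotient.mk (coinvIdeal S) (v i)) '' (Set.univ \ {i}) ⊆
        Set.range (fun j : {j // j ≠ i} => Ideal.Quotient.mk (coinvIdeal S) (v j)) := by
      rintro _ ⟨j, hj, rfl⟩
      exact ⟨⟨j, by simpa using hj⟩, rfl⟩
    by_cases hj : j = i
    · subst hj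
      exact Submodule.span_mono key hi
    · exact Submodule.subset_span ⟨⟨j, hj⟩, rfl⟩)
  have : Fintype.card {j // j ≠ i} < Fintype.card ι :=
    Fintype.card_subtype_lt (x := i) (by simp)
  omega

end LowerBound

section Spanning

lemma exists_monic_of_prod_eq_X_pow {K A ι : Type*} [Field K] [CommRing A] [Nontrivial A]
    [Algebra K A] [DecidableEq ι] (B : Subalgebra K A) (s t : Finset ι) (hts : t ⊆ s) (r : ι → A)
    (hr : ∀ i ∈ t, r i ∈ B)
    (hprod : ∏ i ∈ s, (Polynomial.X - Polynomial.C (r i)) = Polynomial.X ^ #s)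
    {i₀ : ι} (hi₀ : i₀ ∈ s \ t) :
    ∃ q : Polynomial B, q.Monic ∧ q.natDegree = #s - #t ∧ Polynomial.aeval (r i₀) q = 0 := by
  let T : Polynomial B := ∏ i ∈ t.attach, (Polynomial.X - Polynomial.C ⟨r i, hr i i.2⟩)
  have hT : T.Monic := Polynomial.monic_prod_X_sub_C _ _
  have hTmap : T.map (algebraMap B A) = ∏ i ∈ t, (Polynomial.X - Polynomial.C (r i)) := by
    simp only [T, Polynomial.map_prod, Polynomial.map_sub, Polynomial.map_X, Polynomial.map_C]
    exact Finset.prod_attach t fun i => (Polynomial.X - Polynomial.C (r i))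
  have hq : (Polynomial.X ^ #s /ₘ T).map (algebraMap B A) =
      ∏ i ∈ s \ t, (Polynomial.X - Polynomial.C (r i)) := by
    rw [Polynomial.map_divByMonic _ hT, hTmap, Polynomial.map_pow, Polynomial.map_X, ← hprod,
      ← Finset.prod_sdiff hts, mul_comm,
      Polynomial.mul_divByMonic_cancel_left _ (Polynomial.monic_prod_X_sub_C _ _)]
  have hinj : Function.Injective (algebraMap B A) := Subtype.coe_injective
  refine ⟨Polynomial.X ^ #s /ₘ T, Polynomial.monic_of_injective hinj ?_, ?_, ?_⟩
  · rw [hq]; exact Polynomial.monic_prod_X_sub_C _ _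
  · rw [← Polynomial.natDegree_map_eq_of_injective hinj, hq,
      Polynomial.natDegree_finsetProd_X_sub_C_eq_card, Finset.card_sdiff_of_subset hts]
  · rw [← Polynomial.eval_map_algebraMap, hq, Polynomial.eval_prod]
    exact Finset.prod_eq_zero hi₀ (by simp)

/-- If each generator `ξ i` is a root of a monic polynomial of degree `e i` over the subalgebra
generated by the lower-ranked generators, then the monomials with exponents below `e` span. -/
lemma adjoin_le_span_prod_pow {K A ι : Type*} [Field K] [CommRing A] [Algebra K A] [Fintype ι]
    (ρ : ι → ℕ) (hρ : Function.Injective ρ) (ξ : ι → A) (e : ι → ℕ)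
    (h : ∀ i, ∃ q : Polynomial (Algebra.adjoin K (ξ '' {j | ρ j < ρ i})),
      q.Monic ∧ q.natDegree = e i ∧ Polynomial.aeval (ξ i) q = 0) :
    Subalgebra.toSubmodule (Algebra.adjoin K (Set.range ξ)) ≤
      Submodule.span K {x | ∃ b : ι → ℕ, (∀ i, b i < e i) ∧ ∏ i, ξ i ^ b i = x} := by
  classical
  have main : ∀ k, Subalgebra.toSubmodule (Algebra.adjoin K (ξ '' {j | ρ j < k})) ≤
      Submodule.span K {x | ∃ b : ι → ℕ, (∀ i, ρ i < k → b i < e i) ∧ (∀ i, k ≤ ρ i → b i = 0) ∧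
        ∏ i, ξ i ^ b i = x} := by
    intro k
    induction k with
    | zero =>
      intro x hx
      simp only [Nat.not_lt_zero, Set.ofPred_false, Set.image_empty, Algebra.adjoin_empty,
        Subalgebra.mem_toSubmodule, Algebra.mem_bot] at hx
      obtain ⟨c, rfl⟩ := hx
      rw [Algebra.algebraMap_eq_smul_one]
      exact Submodule.smul_mem _ _ (Submodule.subset_span ⟨0, by simp, by simp, by simp⟩)
    | succ k ih =>
      by_cases hk : ∃ i, ρ i = k
      · obtain ⟨i, rfl⟩ := hk
        have hset : ξ '' {j | ρ j < ρ i + 1} = ξ '' {j | ρ j < ρ i} ∪ {ξ i} := by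
          rw [← Set.image_singleton, ← Set.image_union]
          congr 1
          ext j
          simp only [Set.mem_ofPred_eq, Set.mem_union, Set.mem_singleton_iff, ← hρ.eq_iff]
          omega
        obtain ⟨q, hq, hqd, hq0⟩ := h i
        intro x hx
        rw [hset, Algebra.adjoin_union_eq_adjoin_adjoin] at hx
        have hx' : x ∈ Subalgebra.toSubmodule
          (Algebra.adjoin (Algebra.adjoin K (ξ '' {j | ρ j < ρ i})) {ξ i}) := hx
        rw [← Submodule.span_range_natDegree_eq_adjoin hq hq0, hqd] at hx'
        obtain ⟨N, c, g, rfl⟩ := Submodule.mem_span_set'.1 hx'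
        refine sum_mem fun u _ => ?_
        obtain ⟨l, hl, hgl⟩ := Finset.mem_image.1 (Finset.mem_coe.1 (g u).2)
        rw [Finset.mem_range] at hl
        rw [← hgl, Subalgebra.smul_def, smul_eq_mul]
        have ha := ih (c u).2
        generalize (c u : A) = a at ha
        induction ha using Submodule.span_induction with
        | zero => rw [zero_mul]; exact zero_mem _
        | add x y _ _ hx hy => rw [add_mul]; exact add_mem hx hy
        | smul a x _ hx => rw [smul_mul_assoc]; exact Submodule.smul_mem _ _ hx
        | mem x hx =>
          obtain ⟨b, hb, hb0, rfl⟩ := hx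
          refine Submodule.subset_span ⟨Function.update b i l, fun j hj => ?_, fun j hj => ?_, ?_⟩
          · by_cases hji : j = i
            · subst hji; simpa using hl
            · rw [Function.update_of_ne hji]
              have := hρ.ne hji
              exact hb j (by omega)
          · have hji : j ≠ i := by rintro rfl; omega
            rw [Function.update_of_ne hji]
            exact hb0 j (by omega)
          · rw [← Finset.mul_prod_erase _ _ (Finset.mem_univ i),
              ← Finset.mul_prod_erase _ (fun i => ξ i ^ b i) (Finset.mem_univ i),
              hb0 i le_rfl, pow_zero, one_mul, Function.update_self, mul_comm]
            congr 1
            refine Finset.prod_congr rfl fun j hj => ?_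
            rw [Function.update_of_ne (Finset.ne_of_mem_erase hj)]
      · push Not at hk
        have h1 : ∀ j, ρ j < k + 1 ↔ ρ j < k := fun j => by have := hk j; omega
        have h2 : ∀ j, k + 1 ≤ ρ j ↔ k ≤ ρ j := fun j => by have := hk j; omega
        simpa only [h1, h2] using ih
  have hlt : ∀ i, ρ i < (∑ j, ρ j) + 1 := fun i =>
    Nat.lt_succ_of_le (Finset.single_le_sum (fun j _ => Nat.zero_le (ρ j)) (Finset.mem_univ i))
  have hset : {j | ρ j < (∑ j, ρ j) + 1} = Set.univ := Set.eq_univ_of_forall hlt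
  have := main ((∑ j, ρ j) + 1)
  rw [hset, Set.image_univ] at this
  refine this.trans (Submodule.span_mono ?_)
  rintro x ⟨b, hb, -, hx⟩
  exact ⟨b, fun i => hb i (hlt i), hx⟩

end Spanning

section LinearForms

variable {K : Type*} [Field K] {n : ℕ}

/-- The linear form with coefficient vector `u`. -/
noncomputable def linForm (u : Fin n → K) : MvPolynomial (Fin n) K := ∑ i, C (u i) * X i

lemma linForm_add (u v : Fin n → K) : linForm (u + v) = linForm u + linForm v := by
  simp [linForm, add_mul, Finset.sum_add_distrib]

lemma linForm_smul (c : K) (u : Fin n → K) : linForm (c • u) = C c * linForm u := by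
  simp [linForm, Finset.mul_sum, mul_assoc]

lemma linForm_single (i : Fin n) : linForm (Pi.single i 1 : Fin n → K) = X i := by
  rw [linForm, Finset.sum_eq_single i]
  · simp
  · intro j _ hj; simp [hj]
  · simp

lemma linForm_isHomogeneous (u : Fin n → K) : (linForm u).IsHomogeneous 1 := by
  refine IsHomogeneous.sum _ _ _ fun i _ => ?_
  simpa using (isHomogeneous_C (Fin n) (u i)).mul (isHomogeneous_X K i)

lemma matAct_linForm (g : Matrix (Fin n) (Fin n) K) (u : Fin n → K) :
    matAct g (linForm u) = linForm (g.mulVec u) := by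
  simp only [linForm, map_sum, map_mul, matAct_X, Matrix.mulVec, dotProduct, Finset.sum_mul,
    Finset.mul_sum]
  rw [Finset.sum_comm]
  refine Finset.sum_congr rfl fun i _ => Finset.sum_congr rfl fun j _ => ?_
  rw [← algebraMap_eq, AlgHom.commutes]
  ring

/-- The vectors supported on `T`. -/
noncomputable def coordSpace (K : Type*) [Field K] [Fintype K] (T : Finset (Fin n)) :
    Finset (Fin n → K) :=
  open Classical in Fintype.piFinset fun i => if i ∈ T then Finset.univ else {0}

lemma mem_coordSpace [Fintype K] {T : Finset (Fin n)} {u : Fin n → K} :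
    u ∈ coordSpace K T ↔ ∀ i ∉ T, u i = 0 := by
  simp only [coordSpace, Fintype.mem_piFinset]
  refine forall_congr' fun i => ?_
  split_ifs with h <;> simp [h]

lemma card_coordSpace [Fintype K] (T : Finset (Fin n)) :
    #(coordSpace K T) = Fintype.card K ^ #T := by
  rw [coordSpace, Fintype.card_piFinset]
  simp [apply_ite Finset.card]

lemma isHomogeneous_coeff_prod_X_sub_C {σ ι : Type*} {d : ℕ} (f : ι → MvPolynomial σ K)
    (hf : ∀ i, (f i).IsHomogeneous d) (s : Finset ι) (k l : ℕ) (hkl : k + l = #s) :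
    ((∏ i ∈ s, (Polynomial.X - Polynomial.C (f i))).coeff k).IsHomogeneous (d * l) := by
  classical
  induction s using Finset.induction_on generalizing k l with
  | empty =>
    obtain ⟨rfl, rfl⟩ : k = 0 ∧ l = 0 := by simpa using hkl
    simpa using isHomogeneous_one σ K
  | insert i s hi ih =>
    rw [Finset.card_insert_of_notMem hi] at hkl
    have hmul : ∀ l', k + l' = #s → (f i *
        (∏ i ∈ s, (Polynomial.X - Polynomial.C (f i))).coeff k).IsHomogeneous (d * (l' + 1)) := by
      intro l' h
      have := (hf i).mul (ih k l' h)
      rwa [show d + d * l' = d * (l' + 1) by ring] at this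
    have htop : l = 0 → (∏ i ∈ s, (Polynomial.X - Polynomial.C (f i))).coeff k = 0 := by
      intro h
      refine Polynomial.coeff_eq_zero_of_natDegree_lt ?_
      rw [Polynomial.natDegree_finsetProd_X_sub_C_eq_card]
      omega
    have hmul' : (f i *
        (∏ i ∈ s, (Polynomial.X - Polynomial.C (f i))).coeff k).IsHomogeneous (d * l) := by
      rcases l with _ | l
      · rw [htop rfl, mul_zero]; exact isHomogeneous_zero _ _ _
      · exact hmul l (by omega)
    rw [Finset.prod_insert hi, sub_mul, Polynomial.coeff_sub, Polynomial.coeff_C_mul]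
    refine IsHomogeneous.sub ?_ hmul'
    rcases k with _ | k
    · rw [Polynomial.coeff_X_mul_zero]; exact isHomogeneous_zero _ _ _
    · rw [Polynomial.coeff_X_mul]
      exact ih k l (by omega)

/-- A product of factors `X - f i` fixed by `S`, with the `f i` homogeneous of the same positive
degree, becomes a power of `X` over the coinvariants. -/
lemma map_prod_X_sub_C_eq_X_pow (S : Set (GL (Fin n) K)) {ι : Type*} {d : ℕ} (hd : 0 < d)
    (f : ι → MvPolynomial (Fin n) K) (hf : ∀ i, (f i).IsHomogeneous d) (s : Finset ι)
    (hS : ∀ g ∈ S, ∏ i ∈ s, (Polynomial.X -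
        Polynomial.C (matAct ((g : GL (Fin n) K) : Matrix (Fin n) (Fin n) K) (f i))) =
      ∏ i ∈ s, (Polynomial.X - Polynomial.C (f i))) :
    ∏ i ∈ s, (Polynomial.X - Polynomial.C (Ideal.Quotient.mk (coinvIdeal S) (f i))) =
      Polynomial.X ^ #s := by
  set F := ∏ i ∈ s, (Polynomial.X - Polynomial.C (f i)) with hF
  have hmap : ∀ {R : Type _} [CommRing R] (φ : MvPolynomial (Fin n) K →+* R), F.map φ =
      ∏ i ∈ s, (Polynomial.X - Polynomial.C (φ (f i))) := by
    intro R _ φ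
    simp [hF, Polynomial.map_prod]
  have hmonic : F.Monic := Polynomial.monic_prod_X_sub_C _ _
  have hdeg : F.natDegree = #s := Polynomial.natDegree_finsetProd_X_sub_C_eq_card _ _
  rw [← hmap (Ideal.Quotient.mk (coinvIdeal S))]
  ext k
  rw [Polynomial.coeff_map, Polynomial.coeff_X_pow]
  rcases lt_trichotomy k #s with hk | rfl | hk
  · rw [if_neg hk.ne, Ideal.Quotient.eq_zero_iff_mem]
    refine Ideal.subset_span ⟨fun g hg => ?_, d * (#s - k), Nat.mul_pos hd (by omega), ?_⟩
    · have h := hmap (matAct ((g : GL (Fin n) K) : Matrix (Fin n) (Fin n) K)).toRingHom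
      have h' := congrArg (Polynomial.coeff · k) (h.trans (hS g hg))
      simpa [Polynomial.coeff_map] using h'
    · exact isHomogeneous_coeff_prod_X_sub_C f hf s k _ (by omega)
  · rw [if_pos rfl, ← hdeg, hmonic.coeff_natDegree, map_one]
  · rw [if_neg hk.ne', Polynomial.coeff_eq_zero_of_natDegree_lt (by omega), map_zero]

lemma mulVec_injective_of_GL {n : ℕ} (g : GL (Fin n) K) :
    Function.Injective (g : Matrix (Fin n) (Fin n) K).mulVec :=
  Matrix.mulVec_injective_iff_isUnit.2 g.isUnit

lemma isUnit_monomialMatrix {ι : Type*} [Fintype ι] [DecidableEq ι] (σ : Equiv.Perm ι)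
    {w : ι → K} (hw : ∀ j, w j ≠ 0) :
    IsUnit (Matrix.of fun j k => if j = σ k then w k else 0) := by
  have h : (Matrix.of fun j k => if j = σ k then w k else 0) =
      (σ⁻¹.permMatrix K) * Matrix.diagonal w := by
    ext j k
    simp [Matrix.mul_diagonal, PEquiv.toMatrix_apply, Equiv.toPEquiv_apply, Equiv.symm_apply_eq]
  rw [h]
  refine IsUnit.mul ?_ ?_
  · rw [Matrix.isUnit_iff_isUnit_det, Matrix.det_permutation]
    exact (Units.isUnit (Equiv.Perm.sign σ⁻¹)).map (Int.castRingHom K)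
  · rw [Matrix.isUnit_diagonal, Pi.isUnit_iff]
    exact fun j => (hw j).isUnit

end LinearForms

section CartanWeyl

variable {K : Type*} [Field K] [Fintype K] {n1 n2 m : ℕ}

/-- The indices of the first block that are at least `a`. -/
def blockTail (n1 n2 a : ℕ) : Finset (Fin (n1 + n2)) :=
  Finset.univ.filter fun i => a ≤ (i : ℕ) ∧ (i : ℕ) < n1

lemma mem_blockTail {a : ℕ} {i : Fin (n1 + n2)} :
    i ∈ blockTail n1 n2 a ↔ a ≤ (i : ℕ) ∧ (i : ℕ) < n1 := by
  simp [blockTail]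

lemma card_blockTail (a : ℕ) : #(blockTail n1 n2 a) = n1 - a := by
  rw [← Nat.card_Ico, ← Finset.card_map Fin.valEmbedding]
  congr 1
  ext i
  simp only [Finset.mem_map, mem_blockTail, Fin.valEmbedding_apply, Finset.mem_Ico]
  constructor
  · rintro ⟨j, hj, rfl⟩; exact hj
  · intro h; exact ⟨⟨i, by omega⟩, h, rfl⟩

lemma prod_comp_of_injective_of_mapsTo {α M : Type*} [CommMonoid M] (V : Finset α) (φ : α → α)
    (hφ : Function.Injective φ) (hV : ∀ u ∈ V, φ u ∈ V) (f : α → M) :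
    ∏ u ∈ V, f (φ u) = ∏ u ∈ V, f u := by
  have h : V.map ⟨φ, hφ⟩ = V := by
    refine Finset.eq_of_subset_of_card_le ?_ (by rw [Finset.card_map])
    intro x hx
    obtain ⟨u, hu, rfl⟩ := Finset.mem_map.1 hx
    exact hV u hu
  conv_rhs => rw [← h, Finset.prod_map]
  rfl

lemma mulVec_mem_coordSpace {g : GL (Fin (n1 + n2)) K} (hg : g ∈ cartanWeyl K n1 n2 m)
    (u : Fin (n1 + n2) → K) (hu : u ∈ coordSpace K (blockTail n1 n2 0)) :
    (g : Matrix _ _ K).mulVec u ∈ coordSpace K (blockTail n1 n2 0) := by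
  simp only [mem_coordSpace, mem_blockTail, zero_le, true_and, not_lt] at hu ⊢
  intro i hi
  rw [Matrix.mulVec, dotProduct]
  refine Finset.sum_eq_zero fun t _ => ?_
  by_cases ht : (t : ℕ) < n1
  · rw [hg.1 i t hi ht, zero_mul]
  · rw [hu t (by omega), mul_zero]

/-- The product of the translates of `x_{n1+j}` by the linear forms in `x_1, …, x_{n1}`. -/
noncomputable def orbitProd (K : Type*) [Field K] [Fintype K] (n1 : ℕ) {n2 : ℕ} (j : Fin n2) :
    MvPolynomial (Fin (n1 + n2)) K :=
  ∏ u ∈ coordSpace K (blockTail n1 n2 0), (X (Fin.natAdd n1 j) - linForm u)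

lemma orbitProd_isHomogeneous (j : Fin n2) :
    (orbitProd K n1 j).IsHomogeneous (Fintype.card K ^ n1) := by
  have := IsHomogeneous.prod (coordSpace K (blockTail n1 n2 0))
    (fun u => X (Fin.natAdd n1 j) - linForm u) (fun _ => 1)
    (fun u _ => (isHomogeneous_X K _).sub (linForm_isHomogeneous u))
  rwa [Finset.sum_const, card_coordSpace, card_blockTail, smul_eq_mul, mul_one] at this

lemma matAct_orbitProd {g : GL (Fin (n1 + n2)) K} (hg : g ∈ cartanWeyl K n1 n2 m)
    (j k : Fin n2) {w : K} (hw : w ≠ 0)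
    (hgw : ∀ i : Fin n2, (g : Matrix _ _ K) (Fin.natAdd n1 i) (Fin.natAdd n1 j) =
      if i = k then w else 0) :
    matAct (g : Matrix (Fin (n1 + n2)) (Fin (n1 + n2)) K) (orbitProd K n1 j) =
      C w ^ (Fintype.card K ^ n1) * orbitProd K n1 k := by
  set V := coordSpace K (blockTail n1 n2 0)
  set b : Fin (n1 + n2) → K := (g : Matrix _ _ K).mulVec (Pi.single (Fin.natAdd n1 j) 1) -
    w • Pi.single (Fin.natAdd n1 k) 1 with hb
  have hbV : b ∈ V := by
    simp only [V, mem_coordSpace, mem_blockTail, zero_le, true_and, not_lt]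
    intro i hi
    obtain ⟨i, rfl⟩ : ∃ i' : Fin n2, Fin.natAdd n1 i' = i :=
      ⟨⟨i - n1, by omega⟩, Fin.ext (by simp; omega)⟩
    simp [hb, hgw, Pi.single_apply]
  have hX : matAct (g : Matrix (Fin (n1 + n2)) (Fin (n1 + n2)) K) (X (Fin.natAdd n1 j)) =
      C w * X (Fin.natAdd n1 k) + linForm b := by
    rw [← linForm_single, matAct_linForm, ← linForm_single, ← linForm_smul, ← linForm_add, hb]
    congr 1
    abel
  have hmul : ∀ u, matAct (g : Matrix (Fin (n1 + n2)) (Fin (n1 + n2)) K)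
      (X (Fin.natAdd n1 j) - linForm u) = C w * X (Fin.natAdd n1 k) + linForm b -
        linForm ((g : Matrix _ _ K).mulVec u) := fun u => by
    rw [map_sub, hX, matAct_linForm]
  rw [orbitProd, map_prod, Finset.prod_congr rfl fun u _ => hmul u,
    prod_comp_of_injective_of_mapsTo V _ (mulVec_injective_of_GL g)
      (fun u hu => mulVec_mem_coordSpace hg u hu)
      (fun u => C w * X (Fin.natAdd n1 k) + linForm b - linForm u),
    ← prod_comp_of_injective_of_mapsTo V (fun u => w • u + b) (fun u v h => ?_) (fun u hu => ?_)
      (fun u => C w * X (Fin.natAdd n1 k) + linForm b - linForm u)]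
  · have hV : #V = Fintype.card K ^ n1 := by
      rw [card_coordSpace, card_blockTail, Nat.sub_zero]
    rw [orbitProd, ← hV, ← Finset.prod_const, ← Finset.prod_mul_distrib]
    refine Finset.prod_congr rfl fun u _ => ?_
    rw [linForm_add, linForm_smul]
    ring
  · exact smul_right_injective _ hw (add_right_cancel h)
  · simp only [V, mem_coordSpace] at hu hbV ⊢
    intro i hi
    simp [hu i hi, hbV i hi]

lemma prod_X_sub_C_linForm_eq_X_pow :
    ∏ u ∈ coordSpace K (blockTail n1 n2 0), (Polynomial.X - Polynomial.C
      (Ideal.Quotient.mk (coinvIdeal (cartanWeyl K n1 n2 m)) (linForm u))) =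
    Polynomial.X ^ #(coordSpace K (blockTail n1 n2 0)) := by
  refine map_prod_X_sub_C_eq_X_pow _ one_pos _ linForm_isHomogeneous _ fun g hg => ?_
  simp only [matAct_linForm]
  exact prod_comp_of_injective_of_mapsTo _ _ (mulVec_injective_of_GL g)
    (fun u hu => mulVec_mem_coordSpace hg u hu)
    (fun u => Polynomial.X - Polynomial.C (linForm u))

lemma mk_orbitProd (j : Fin n2) :
    Ideal.Quotient.mk (coinvIdeal (cartanWeyl K n1 n2 m)) (orbitProd K n1 j) =
      Ideal.Quotient.mk _ (X (Fin.natAdd n1 j)) ^ (Fintype.card K ^ n1) := by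
  have h := congrArg (Polynomial.eval (Ideal.Quotient.mk _ (X (Fin.natAdd n1 j))))
    (prod_X_sub_C_linForm_eq_X_pow (K := K) (n1 := n1) (n2 := n2) (m := m))
  rw [Polynomial.eval_prod, Polynomial.eval_pow, Polynomial.eval_X, card_coordSpace,
    card_blockTail, Nat.sub_zero] at h
  rw [← h, orbitProd, map_prod]
  simp

lemma prod_X_sub_C_pow_eq_X_pow (hm : 0 < m) :
    ∏ j : Fin n2, (Polynomial.X - Polynomial.C
      (Ideal.Quotient.mk (coinvIdeal (cartanWeyl K n1 n2 m)) (X (Fin.natAdd n1 j)) ^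
        (m * Fintype.card K ^ n1))) =
    Polynomial.X ^ #(Finset.univ : Finset (Fin n2)) := by
  have h := map_prod_X_sub_C_eq_X_pow (cartanWeyl K n1 n2 m) (ι := Fin n2)
    (Nat.mul_pos (pow_pos Fintype.card_pos n1) hm)
    (fun j => orbitProd K n1 j ^ m) (fun j => (orbitProd_isHomogeneous j).pow m)
    Finset.univ fun g hg => ?_
  · simpa only [map_pow, mk_orbitProd, ← pow_mul, mul_comm] using h
  · obtain ⟨-, σ, w, hw, hgw⟩ := id hg
    have hw0 : ∀ j, w j ≠ 0 := fun j h => by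
      have := hw j
      rw [h, zero_pow hm.ne'] at this
      exact zero_ne_one this
    have key : ∀ j, matAct (g : Matrix (Fin (n1 + n2)) (Fin (n1 + n2)) K)
        (orbitProd K n1 j ^ m) = orbitProd K n1 (σ j) ^ m := fun j => by
      rw [map_pow, matAct_orbitProd hg j (σ j) (hw0 j) (fun i => hgw i j), mul_pow, ← pow_mul,
        mul_comm _ m, pow_mul, ← C_pow, hw, C_1, one_pow, one_mul]
    simp only [key]
    exact Equiv.prod_comp σ fun j => Polynomial.X - Polynomial.C (orbitProd K n1 j ^ m)

end CartanWeyl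

section Basis

variable {K : Type*} [Field K] [Fintype K] {n1 n2 m : ℕ}

lemma span_coinvariants_cartanWeyl (hm : 0 < m) :
    (⊤ : Submodule K (MvPolynomial (Fin (n1 + n2)) K ⧸ coinvIdeal (cartanWeyl K n1 n2 m))) ≤
      Submodule.span K {x | ∃ b : Fin n1 ⊕ Fin n2 → ℕ,
        (∀ s : Fin n1, b (.inl s) <
          Fintype.card K ^ n1 - Fintype.card K ^ (n1 - ((s : ℕ) + 1))) ∧
        (∀ j : Fin n2, b (.inr j) < m * (n2 - (j : ℕ)) * Fintype.card K ^ n1) ∧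
        ∏ i, Ideal.Quotient.mk _ (X (finSumFinEquiv i)) ^ b i = x} := by
  classical
  rcases subsingleton_or_nontrivial
    (MvPolynomial (Fin (n1 + n2)) K ⧸ coinvIdeal (cartanWeyl K n1 n2 m)) with hA | hA
  · intro x _
    rw [Subsingleton.elim x 0]
    exact zero_mem _
  set q := Fintype.card K
  let ξ : Fin n1 ⊕ Fin n2 →
      MvPolynomial (Fin (n1 + n2)) K ⧸ coinvIdeal (cartanWeyl K n1 n2 m) :=
    fun i => Ideal.Quotient.mk _ (X (finSumFinEquiv i))
  let e : Fin n1 ⊕ Fin n2 → ℕ := Sum.elim (fun s => q ^ n1 - q ^ (n1 - ((s : ℕ) + 1)))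
    (fun j => m * (n2 - (j : ℕ)) * q ^ n1)
  let ρ : Fin n1 ⊕ Fin n2 → ℕ := Sum.elim (fun s => n1 - 1 - s) (fun j => n1 + j)
  have hρ : Function.Injective ρ := by
    rintro (s | s) (t | t) h <;> simp only [ρ, Sum.elim_inl, Sum.elim_inr] at h
    · exact congrArg _ (Fin.ext (by omega))
    · omega
    · omega
    · exact congrArg _ (Fin.ext (by omega))
  have hspan := adjoin_le_span_prod_pow (K := K) ρ hρ ξ e fun i => ?_
  · have htop : Algebra.adjoin K (Set.range ξ) = ⊤ := by
      have h := congrArg (Subalgebra.map (Ideal.Quotient.mkₐ K (coinvIdeal (cartanWeyl K n1 n2 m))))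
        (adjoin_range_X (R := K) (σ := Fin (n1 + n2)))
      rw [AlgHom.map_adjoin, Algebra.map_top, (AlgHom.range_eq_top _).2
        (Ideal.Quotient.mkₐ_surjective K _), ← Set.range_comp] at h
      rw [← h, ← finSumFinEquiv.surjective.range_comp]
      rfl
    rw [htop, Algebra.top_toSubmodule] at hspan
    refine hspan.trans (Submodule.span_mono ?_)
    rintro x ⟨b, hb, rfl⟩
    exact ⟨b, fun s => hb (.inl s), fun j => hb (.inr j), rfl⟩
  · rcases i with s | j
    · have hsub : coordSpace K (blockTail n1 n2 (s + 1)) ⊆ coordSpace K (blockTail n1 n2 0) := by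
        intro u hu
        rw [mem_coordSpace] at hu ⊢
        intro i hi
        refine hu i fun h => hi ?_
        rw [mem_blockTail] at h ⊢
        omega
      have hmem : ∀ u ∈ coordSpace K (blockTail n1 n2 (s + 1)),
          Ideal.Quotient.mk (coinvIdeal (cartanWeyl K n1 n2 m)) (linForm u) ∈
            Algebra.adjoin K (ξ '' {j | ρ j < ρ (.inl s)}) := by
        intro u hu
        rw [linForm, map_sum]
        refine sum_mem fun i _ => ?_
        rw [map_mul]
        by_cases hi : i ∈ blockTail n1 n2 (s + 1)
        · rw [mem_blockTail] at hi
          refine mul_mem ?_ (Algebra.subset_adjoin ⟨.inl ⟨i, hi.2⟩, ?_, ?_⟩)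
          · exact Subalgebra.algebraMap_mem _ (u i)
          · simp only [Set.mem_ofPred_eq, ρ, Sum.elim_inl]
            omega
          · rfl
        · rw [mem_coordSpace.1 hu i hi, C_0, map_zero, zero_mul]
          exact zero_mem _
      have hs : (Pi.single (Fin.castAdd n2 s) 1 : Fin (n1 + n2) → K) ∈
          coordSpace K (blockTail n1 n2 0) \ coordSpace K (blockTail n1 n2 (s + 1)) := by
        rw [Finset.mem_sdiff, mem_coordSpace, mem_coordSpace]
        constructor
        · intro i hi
          refine Pi.single_eq_of_ne ?_ _
          rintro rfl
          exact hi (mem_blockTail.2 ⟨Nat.zero_le _, s.2⟩)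
        · intro h
          have := h (Fin.castAdd n2 s) (by simp [mem_blockTail])
          simp at this
      obtain ⟨f, hf, hfd, hf0⟩ := exists_monic_of_prod_eq_X_pow _ _ _ hsub _ hmem
        prod_X_sub_C_linForm_eq_X_pow hs
      refine ⟨f, hf, ?_, ?_⟩
      · rw [hfd, card_coordSpace, card_coordSpace, card_blockTail, card_blockTail, Nat.sub_zero]
        rfl
      · rwa [linForm_single] at hf0
    · have hmem : ∀ i ∈ Finset.univ.filter (· < j), ξ (.inr i) ^ (m * q ^ n1) ∈
          Algebra.adjoin K (ξ '' {i | ρ i < ρ (.inr j)}) := by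
        intro i hi
        have hij : ρ (.inr i) < ρ (.inr j) := by
          have : i < j := by simpa using hi
          simp only [ρ, Sum.elim_inr]
          omega
        exact pow_mem (Algebra.subset_adjoin (Set.mem_image_of_mem ξ hij)) _
      obtain ⟨f, hf, hfd, hf0⟩ := exists_monic_of_prod_eq_X_pow _ _ _ (Finset.subset_univ _)
        (fun j => ξ (.inr j) ^ (m * q ^ n1)) hmem (prod_X_sub_C_pow_eq_X_pow hm) (i₀ := j) (by simp)
      refine ⟨Polynomial.expand _ (m * q ^ n1) f,
        hf.expand (Nat.mul_pos hm (pow_pos Fintype.card_pos _)), ?_, ?_⟩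
      · have hj : #(Finset.univ.filter (· < j)) = (j : ℕ) := by
          rw [Finset.filter_gt_eq_Iio, Fin.card_Iio]
        rw [Polynomial.natDegree_expand, hfd, Finset.card_univ, Fintype.card_fin, hj]
        simp only [e, Sum.elim_inr]
        ring
      · rw [Polynomial.expand_aeval]
        exact hf0

lemma le_card_cartanWeyl (hm : 0 < m) {r : ℕ} (hr : r ≤ Nat.card {w : K // w ^ m = 1}) :
    (∏ s : Fin n1, (Fintype.card K ^ n1 - Fintype.card K ^ (n1 - ((s : ℕ) + 1)))) *
      ∏ j : Fin n2, (r * (n2 - (j : ℕ)) * Fintype.card K ^ n1) ≤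
    Nat.card (cartanWeyl K n1 n2 m) := by
  classical
  have hw0 : ∀ w : {w : K // w ^ m = 1}, (w : K) ≠ 0 := fun w h => by
    have := w.2
    rw [h, zero_pow hm.ne'] at this
    exact zero_ne_one this
  let D := GL (Fin n1) K × Matrix (Fin n1) (Fin n2) K × Equiv.Perm (Fin n2) ×
    (Fin n2 → {w : K // w ^ m = 1})
  let blk : D → Matrix (Fin n1 ⊕ Fin n2) (Fin n1 ⊕ Fin n2) K := fun x =>
    Matrix.fromBlocks x.1 x.2.1 0
      (Matrix.of fun j k => if j = x.2.2.1 k then (x.2.2.2 k : K) else 0)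
  have hblk : ∀ x, IsUnit (Matrix.reindexAlgEquiv K K finSumFinEquiv (blk x)) := fun x =>
    (Matrix.isUnit_fromBlocks_zero₂₁.2
      ⟨x.1.isUnit, isUnit_monomialMatrix x.2.2.1 fun j => hw0 _⟩).map _
  have hmem : ∀ x, (hblk x).unit ∈ cartanWeyl K n1 n2 m := by
    intro x
    refine ⟨fun s t hs ht => ?_, x.2.2.1, fun j => x.2.2.2 j, fun j => (x.2.2.2 j).2, fun j k => ?_⟩
    · obtain ⟨s, rfl⟩ := finSumFinEquiv.surjective s
      obtain ⟨t, rfl⟩ := finSumFinEquiv.surjective t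
      rcases s with s | s
      · simp at hs; omega
      rcases t with t | t
      · simp [blk, -finSumFinEquiv_apply_left, -finSumFinEquiv_apply_right]
      · simp at ht
    · rw [← finSumFinEquiv_apply_right, ← finSumFinEquiv_apply_right]
      simp [blk, -finSumFinEquiv_apply_right]
  have hinj : Function.Injective fun x : D => (⟨(hblk x).unit, hmem x⟩ : cartanWeyl K n1 n2 m) := by
    intro x y hxy
    have h : blk x = blk y := (Matrix.reindexAlgEquiv K K finSumFinEquiv).injective
      (congrArg Units.val (congrArg Subtype.val hxy))
    obtain ⟨hA, hB, -, hC⟩ := Matrix.fromBlocks_inj.1 h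
    have hC' : ∀ j k, (if j = x.2.2.1 k then (x.2.2.2 k : K) else 0) =
        if j = y.2.2.1 k then (y.2.2.2 k : K) else 0 := fun j k => congrFun (congrFun hC j) k
    have hσ : ∀ k, x.2.2.1 k = y.2.2.1 k := fun k => by
      by_contra hne
      have := hC' (x.2.2.1 k) k
      rw [if_pos rfl, if_neg hne] at this
      exact hw0 _ this
    refine Prod.ext (Units.ext hA) (Prod.ext hB (Prod.ext (Equiv.ext hσ) (funext fun k => ?_)))
    have := hC' (x.2.2.1 k) k
    rw [if_pos rfl, if_pos (hσ k)] at this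
    exact Subtype.ext this
  refine le_trans ?_ (Nat.card_le_card_of_injective _ hinj)
  have hB : Nat.card (Matrix (Fin n1) (Fin n2) K) = Fintype.card K ^ (n1 * n2) := by
    rw [Matrix, Nat.card_fun, Nat.card_fun, Nat.card_fin, Nat.card_fin, Nat.card_eq_fintype_card,
      ← pow_mul, mul_comm]
  rw [Nat.card_prod, Nat.card_prod, Nat.card_prod, Matrix.card_GL_field, Nat.card_perm,
    Nat.card_fun, hB, Nat.card_fin,
    Finset.prod_mul_distrib, Finset.prod_mul_distrib]
  simp only [Finset.prod_const, Finset.card_univ, Fintype.card_fin]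
  have h1 : ∏ s : Fin n1, (Fintype.card K ^ n1 - Fintype.card K ^ (n1 - ((s : ℕ) + 1))) =
      ∏ s : Fin n1, (Fintype.card K ^ n1 - Fintype.card K ^ (s : ℕ)) := by
    rw [← Equiv.prod_comp Fin.revPerm]
    refine Finset.prod_congr rfl fun s _ => ?_
    rw [Fin.revPerm_apply, Fin.val_rev]
    congr 2
    omega
  have h2 : ∏ j : Fin n2, (n2 - (j : ℕ)) = n2.factorial := by
    rw [← Equiv.prod_comp Fin.revPerm, ← Finset.prod_range_add_one_eq_factorial,
      ← Fin.prod_univ_eq_prod_range (· + 1)]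
    refine Finset.prod_congr rfl fun j _ => ?_
    rw [Fin.revPerm_apply, Fin.val_rev]
    omega
  rw [h1, h2, pow_mul]
  refine Nat.mul_le_mul_left _ ?_
  rw [mul_comm, mul_comm (r ^ n2)]
  exact Nat.mul_le_mul_left _ (Nat.mul_le_mul_left _ (Nat.pow_le_pow_left hr _))

lemma le_card_pow_eq_one (hm : m = 1 ∨ m = 2) (hodd : m = 2 → Odd (Fintype.card K)) :
    m ≤ Nat.card {w : K // w ^ m = 1} := by
  rcases hm with rfl | rfl
  · exact Nat.card_pos_iff.2 ⟨⟨⟨1, by simp⟩⟩, inferInstance⟩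
  · have hne : (1 : K) ≠ -1 := by
      refine (Ring.neg_one_ne_one_of_char_ne_two fun h => ?_).symm
      exact Nat.not_even_iff_odd.2 (hodd rfl)
        (Nat.even_iff.2 (FiniteField.even_card_of_char_two h))
    have : Nontrivial {w : K // w ^ 2 = 1} :=
      ⟨⟨1, by simp⟩, ⟨-1, by simp⟩, fun h => hne (congrArg Subtype.val h)⟩
    exact Finite.one_lt_card

end Basis

/-- let `q = p` be prime, `n = n1 + n2`, `m ∈ {1, 2}` with `p` odd
if `m = 2`, and let `G_I` be the Weyl group of a restricted Cartan type Lie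
algebra of type `W`, `S` or `H` as above.  Then the monomial
`x_1^{p^{n1}-p^{n1-1}-1} ⋯ x_{n1}^{p^{n1}-2} · Π_{j=1}^{n2} x_{n1+j}^{m(n2+1-j)p^{n1}-1}`
generates a block basis for the coinvariant algebra `P_{G_I}`: its monomial
factors project to an `F_p`-basis of `P/I_{G_I}`. -/
theorem statement19 {K : Type*} [Field K] [Fintype K] {p : ℕ} (hp : p.Prime)
    (hcard : Fintype.card K = p)
    (n1 n2 m : ℕ) (hn1 : 1 ≤ n1) (hn2 : 1 ≤ n2)
    (hm : m = 1 ∨ m = 2) (hodd : m = 2 → Odd p) :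
    LinearIndependent K
      (fun b : {b : (Fin n1 → ℕ) × (Fin n2 → ℕ) //
          (∀ s : Fin n1, b.1 s ≤ p ^ n1 - p ^ (n1 - ((s : ℕ) + 1)) - 1) ∧
          (∀ j : Fin n2, b.2 j ≤ m * (n2 - (j : ℕ)) * p ^ n1 - 1)} =>
        Ideal.Quotient.mk (coinvIdeal (cartanWeyl K n1 n2 m))
          ((∏ s : Fin n1, X (Fin.castAdd n2 s) ^ b.1.1 s) *
            ∏ j : Fin n2, X (Fin.natAdd n1 j) ^ b.1.2 j)) ∧
    Submodule.span K
      (Set.range (fun b : {b : (Fin n1 → ℕ) × (Fin n2 → ℕ) //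
          (∀ s : Fin n1, b.1 s ≤ p ^ n1 - p ^ (n1 - ((s : ℕ) + 1)) - 1) ∧
          (∀ j : Fin n2, b.2 j ≤ m * (n2 - (j : ℕ)) * p ^ n1 - 1)} =>
        Ideal.Quotient.mk (coinvIdeal (cartanWeyl K n1 n2 m))
          ((∏ s : Fin n1, X (Fin.castAdd n2 s) ^ b.1.1 s) *
            ∏ j : Fin n2, X (Fin.natAdd n1 j) ^ b.1.2 j))) = ⊤ := by
  subst hcard
  classical
  have hm0 : 0 < m := by omega
  have hq : 1 < Fintype.card K := hp.one_lt
  have he1 : ∀ s : Fin n1,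
      0 < Fintype.card K ^ n1 - Fintype.card K ^ (n1 - ((s : ℕ) + 1)) := fun s =>
    Nat.sub_pos_of_lt (Nat.pow_lt_pow_right hq (by omega))
  have he2 : ∀ j : Fin n2, 0 < m * (n2 - (j : ℕ)) * Fintype.card K ^ n1 := fun j =>
    Nat.mul_pos (Nat.mul_pos hm0 (by omega)) (pow_pos (by omega) _)
  set ι := {b : (Fin n1 → ℕ) × (Fin n2 → ℕ) //
    (∀ s : Fin n1, b.1 s ≤ Fintype.card K ^ n1 - Fintype.card K ^ (n1 - ((s : ℕ) + 1)) - 1) ∧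
    (∀ j : Fin n2, b.2 j ≤ m * (n2 - (j : ℕ)) * Fintype.card K ^ n1 - 1)}
  let toFin : ι → (∀ s : Fin n1,
        Fin (Fintype.card K ^ n1 - Fintype.card K ^ (n1 - ((s : ℕ) + 1)))) ×
      (∀ j : Fin n2, Fin (m * (n2 - (j : ℕ)) * Fintype.card K ^ n1)) := fun b =>
    (fun s => ⟨b.1.1 s, by have := b.2.1 s; have := he1 s; omega⟩,
      fun j => ⟨b.1.2 j, by have := b.2.2 j; have := he2 j; omega⟩)
  have htoFin : Function.Injective toFin := by
    intro b c h
    refine Subtype.ext (Prod.ext (funext fun s => ?_) (funext fun j => ?_))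
    · exact congrArg Fin.val (congrFun (congrArg Prod.fst h) s)
    · exact congrArg Fin.val (congrFun (congrArg Prod.snd h) j)
  have hfin : Fintype ι := Fintype.ofInjective toFin htoFin
  have hspan : Submodule.span K (Set.range (fun b : ι =>
      Ideal.Quotient.mk (coinvIdeal (cartanWeyl K n1 n2 m))
        ((∏ s : Fin n1, X (Fin.castAdd n2 s) ^ b.1.1 s) *
          ∏ j : Fin n2, X (Fin.natAdd n1 j) ^ b.1.2 j))) = ⊤ := by
    refine top_le_iff.1 ((span_coinvariants_cartanWeyl hm0).trans (Submodule.span_mono ?_))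
    rintro _ ⟨b, hb1, hb2, rfl⟩
    refine ⟨⟨(fun s => b (.inl s), fun j => b (.inr j)),
      fun s => Nat.le_sub_one_of_lt (hb1 s), fun j => Nat.le_sub_one_of_lt (hb2 j)⟩, ?_⟩
    simp [Fintype.prod_sum_type]
  refine ⟨linearIndependent_of_span_coinvariants _ ?_ _ (fun b => ?_) hspan, hspan⟩
  · refine (Fintype.card_le_of_injective _ htoFin).trans ?_
    simpa [Fintype.card_prod, Fintype.card_pi] using
      le_card_cartanWeyl (n1 := n1) (n2 := n2) hm0 (le_card_pow_eq_one hm hodd)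
  · exact ⟨_, (IsHomogeneous.prod _ _ _ fun s _ => (isHomogeneous_X K _).pow _).mul
      (IsHomogeneous.prod _ _ _ fun j _ => (isHomogeneous_X K _).pow _)⟩
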